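/- arXiv:1810.00148 — 4 statements merged into one kernel-verified Lean document; each statement's English description precedes it below -/
import Mathlib

section
/- Let ψ : Π_{i∈I} k → Π_{j∈J} k be a k-linear map and set ψ_{ij} = π_j(ψ(δ_i)). Then ψ is continuous (for the product topologies with k discrete) if and only if: for every j ∈ J the set {i ∈ I : ψ_{ij} ≠ 0} is finite, and for every c ∈ Π_{i∈I} k and every j ∈ J one has π_j(ψ(c)) = Σ_{i∈I} c_i · ψ_{ij} (a sum with only finitely many nonzero terms). -/
/-- A continuous linear functional on `I → k`, with `k` discrete, vanishes on all functions
vanishing on some finite set of coordinates. -/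
theorem LinearMap.exists_finset_forall_eq_zero_of_continuous {k I : Type*} [Field k]
    [TopologicalSpace k] [DiscreteTopology k] (f : (I → k) →ₗ[k] k) (hf : Continuous f) :
    ∃ s : Finset I, ∀ c : I → k, (∀ i ∈ s, c i = 0) → f c = 0 := by
  obtain ⟨s, u, hu, hsub⟩ :=
    isOpen_pi_iff.1 ((isOpen_discrete ({0} : Set k)).preimage hf) 0 (map_zero f)
  refine ⟨s, fun c hc => hsub fun i hi => ?_⟩
  rw [hc i hi]
  exact (hu i hi).2

/-- A linear functional on `I → k` vanishing on all functions that vanish on `s` is determined by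
its values on the `Pi.single i 1` with `i ∈ s`. -/
theorem LinearMap.apply_eq_sum_of_forall_eq_zero {k I : Type*} [Field k] [DecidableEq I]
    (f : (I → k) →ₗ[k] k) (s : Finset I) (hs : ∀ c : I → k, (∀ i ∈ s, c i = 0) → f c = 0)
    (c : I → k) : f c = ∑ i ∈ s, c i * f (Pi.single i 1) := by
  have h := hs (c - ∑ i ∈ s, c i • Pi.single i 1) fun i hi => by
    simp [Finset.sum_apply, Pi.single_apply, hi]
  simpa [sub_eq_zero] using h

/-- A linear map `ψ : Π_{i∈I} k → Π_{j∈J} k` is continuous for the product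
topologies (with `k` discrete) iff for every `j` the set
`{i | ψ_{ij} ≠ 0}` is finite (where `ψ_{ij} = ψ(δ_i)_j`) and
`ψ(c)_j = Σᶠ_i c_i · ψ_{ij}` for every `c` and `j`. -/
theorem stmt1 (k : Type*) [Field k] [TopologicalSpace k] [DiscreteTopology k]
    (I J : Type*) [DecidableEq I] (ψ : (I → k) →ₗ[k] (J → k)) :
    Continuous ψ ↔
      ((∀ j : J, {i : I | ψ (Pi.single i 1) j ≠ 0}.Finite) ∧
        ∀ (c : I → k) (j : J), ψ c j = ∑ᶠ i : I, c i * ψ (Pi.single i 1) j) := by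
  constructor
  · intro h
    have key (j : J) : ∃ s : Finset I, {i : I | ψ (Pi.single i 1) j ≠ 0} ⊆ s ∧
        ∀ c : I → k, ψ c j = ∑ i ∈ s, c i * ψ (Pi.single i 1) j := by
      let f : (I → k) →ₗ[k] k := LinearMap.proj j ∘ₗ ψ
      obtain ⟨s, hs⟩ :=
        f.exists_finset_forall_eq_zero_of_continuous ((continuous_apply j).comp h)
      refine ⟨s, fun i hi => ?_, f.apply_eq_sum_of_forall_eq_zero s hs⟩
      by_contra his
      exact hi (hs _ fun l hl => Pi.single_eq_of_ne (ne_of_mem_of_not_mem hl his) 1)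
    refine ⟨fun j => ?_, fun c j => ?_⟩
    · obtain ⟨s, hs, -⟩ := key j
      exact s.finite_toSet.subset hs
    · obtain ⟨s, hs, hsum⟩ := key j
      rw [hsum, finsum_eq_sum_of_support_subset]
      exact fun i hi => hs (right_ne_zero_of_mul hi)
  · rintro ⟨hfin, hsum⟩
    refine continuous_pi fun j => ?_
    have h (c : I → k) :
        ψ c j = ∑ i ∈ (hfin j).toFinset, c i * ψ (Pi.single i 1) j := by
      rw [hsum, finsum_eq_sum_of_support_subset]
      exact fun i hi => by simpa using right_ne_zero_of_mul hi
    rw [funext h]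
    fun_prop
end

section
/- A k-linear map ψ : Π_{i∈I} k → Π_{j∈J} k is continuous (for the product topologies with k discrete) if and only if there exists a k-linear map φ from the space of finitely supported functions J → k to the space of finitely supported functions I → k such that for every finitely supported u : J → k and every v ∈ Π_{i∈I} k one has Σ_{j∈J} u(j) · π_j(ψ(v)) = Σ_{i∈I} (φ(u))(i) · v(i) (both sums finite). That is, the continuous linear maps are exactly the transposes of linear maps between the corresponding direct sums. -/
theorem finsum_mul_eq_linearCombination {k I : Type*} [Field k] (u : I →₀ k) (v : I → k) :
    ∑ᶠ i : I, u i * v i = Finsupp.linearCombination k v u := by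
  rw [Finsupp.linearCombination_apply, Finsupp.sum]
  refine finsum_eq_sum_of_support_subset _ fun i hi => ?_
  simp only [Function.mem_support, Finset.mem_coe, Finsupp.mem_support_iff] at hi ⊢
  exact left_ne_zero_of_mul hi

/-- A continuous linear functional on a product of copies of a discrete field is evaluation
against a finitely supported function. -/
theorem exists_eq_linearCombination_of_continuous {k I : Type*} [Field k] [TopologicalSpace k]
    [DiscreteTopology k] (f : (I → k) →ₗ[k] k) (hf : Continuous f) :
    ∃ a : I →₀ k, ∀ v : I → k, f v = Finsupp.linearCombination k v a := by
  classical
  have hopen : IsOpen (f ⁻¹' {0}) := (isOpen_discrete _).preimage hf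
  obtain ⟨s, t, ht, hs⟩ := isOpen_pi_iff.1 hopen 0 (by simp)
  have hker : ∀ v : I → k, (∀ i ∈ s, v i = 0) → f v = 0 := fun v hv =>
    hs fun i hi => by simpa [hv i hi] using (ht i hi).2
  refine ⟨∑ i ∈ s, Finsupp.single i (f (Pi.single i 1)), fun v => ?_⟩
  have h := hker (v - ∑ i ∈ s, v i • Pi.single i 1) fun i hi => by
    simp [Finset.sum_apply, Pi.single_apply, hi]
  rw [map_sub, sub_eq_zero] at h
  simp [h, mul_comm]

theorem continuous_linearCombination_apply {k I : Type*} [Field k] [TopologicalSpace k]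
    [DiscreteTopology k] (a : I →₀ k) :
    Continuous fun v : I → k => Finsupp.linearCombination k v a := by
  simp only [Finsupp.linearCombination_apply, Finsupp.sum]
  fun_prop

/-- A linear map `ψ : Π_{i∈I} k → Π_{j∈J} k` is continuous for the product
topologies (with `k` discrete) iff it is the transpose of a linear map
`φ : (J →₀ k) → (I →₀ k)` between the corresponding direct sums, in the sense
that `Σ_j u(j)·ψ(v)(j) = Σ_i φ(u)(i)·v(i)` for all finitely supported `u` and
all `v`. -/
theorem stmt2 (k : Type*) [Field k] [TopologicalSpace k] [DiscreteTopology k]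
    (I J : Type*) (ψ : (I → k) →ₗ[k] (J → k)) :
    Continuous ψ ↔
      ∃ φ : (J →₀ k) →ₗ[k] (I →₀ k),
        ∀ (u : J →₀ k) (v : I → k),
          ∑ᶠ j : J, u j * ψ v j = ∑ᶠ i : I, φ u i * v i := by
  simp only [finsum_mul_eq_linearCombination]
  constructor
  · intro h
    choose a ha using fun j => exists_eq_linearCombination_of_continuous
      (LinearMap.proj j ∘ₗ ψ) ((continuous_apply j).comp h)
    refine ⟨Finsupp.linearCombination k a, fun u v => ?_⟩
    suffices h : Finsupp.linearCombination k (ψ v) =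
        Finsupp.linearCombination k v ∘ₗ Finsupp.linearCombination k a from
      LinearMap.congr_fun h u
    ext j
    simpa using ha j v
  · rintro ⟨φ, hφ⟩
    refine continuous_pi fun j => ?_
    have h : (fun v => ψ v j) =
        fun v => Finsupp.linearCombination k v (φ (Finsupp.single j 1)) := by
      funext v
      simpa using hφ (Finsupp.single j 1) v
    rw [h]
    exact continuous_linearCombination_apply _
end

section
/- The coordinate projections π_i : Π_{i∈I} k → k (for i ∈ I) are continuous linear functionals, and they form a basis of the k-vector space of all continuous linear maps Π_{i∈I} k → k (the continuous dual of the linearly compact space Π_{i∈I} k). -/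
/-- A continuous linear functional on `Π_{i∈I} k`, with `k` discrete, depends on only finitely many
coordinates. -/
theorem exists_finset_eq_zero_of_continuous {k I : Type*} [Semiring k] [TopologicalSpace k]
    [DiscreteTopology k] {f : (I → k) →ₗ[k] k} (hf : Continuous f) :
    ∃ s : Finset I, ∀ v : I → k, (∀ i ∈ s, v i = 0) → f v = 0 := by
  have hopen : IsOpen (f ⁻¹' {0}) := (isOpen_discrete _).preimage hf
  obtain ⟨s, u, hu, hsub⟩ := isOpen_pi_iff.1 hopen 0 (map_zero f)
  refine ⟨s, fun v hv => hsub fun i hi => ?_⟩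
  rw [hv i hi]
  exact (hu i hi).2

/-- A continuous linear functional on `Π_{i∈I} k`, with `k` discrete, is a linear combination of
coordinate projections. -/
theorem mem_span_range_proj_of_continuous {k I : Type*} [CommRing k] [TopologicalSpace k]
    [DiscreteTopology k] {f : (I → k) →ₗ[k] k} (hf : Continuous f) :
    f ∈ Submodule.span k (Set.range (LinearMap.proj : I → (I → k) →ₗ[k] k)) := by
  classical
  obtain ⟨s, hs⟩ := exists_finset_eq_zero_of_continuous hf
  have hsum : f = ∑ i ∈ s, f (Pi.single i 1) • (LinearMap.proj i : (I → k) →ₗ[k] k) := by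
    ext v
    have h := hs (v - ∑ i ∈ s, v i • Pi.single i 1) fun j hj => by
      simp [Finset.sum_apply, Pi.single_apply, hj]
    rw [map_sub, sub_eq_zero] at h
    simp [h, mul_comm]
  rw [hsum]
  exact Submodule.sum_mem _ fun i _ =>
    Submodule.smul_mem _ _ (Submodule.subset_span (Set.mem_range_self i))

/-- The coordinate projections `Π_{i∈I} k → k` are linearly independent. -/
theorem linearIndependent_linearMap_proj (k I : Type*) [CommRing k] :
    LinearIndependent k (LinearMap.proj : I → (I → k) →ₗ[k] k) := by
  classical
  rw [linearIndependent_iff']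
  intro s g hg i hi
  simpa [Pi.single_apply, hi] using LinearMap.congr_fun hg (Pi.single i 1)


/-- The coordinate projections `π_i : Π_{i∈I} k → k` are continuous linear
functionals (for the product topology with `k` discrete), and they form a basis
of the `k`-vector space of all continuous linear maps `Π_{i∈I} k → k`:
they are linearly independent and their span is exactly the set of continuous
linear functionals. -/
theorem stmt3 (k : Type*) [Field k] [TopologicalSpace k] [DiscreteTopology k]
    (I : Type*) :
    ∃ proj : I → ((I → k) →ₗ[k] k),
      (∀ (i : I) (v : I → k), proj i v = v i) ∧
      (∀ i : I, Continuous (proj i)) ∧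
      LinearIndependent k proj ∧
      (Submodule.span k (Set.range proj) : Set ((I → k) →ₗ[k] k)) =
        {f : (I → k) →ₗ[k] k | Continuous f} := by
  refine ⟨LinearMap.proj, fun _ _ => rfl, continuous_apply,
    linearIndependent_linearMap_proj k I, ?_⟩
  ext f
  refine ⟨fun hf => ?_, mem_span_range_proj_of_continuous⟩
  induction hf using Submodule.span_induction with
  | mem f hf =>
    obtain ⟨i, rfl⟩ := hf
    exact continuous_apply i
  | zero => exact continuous_const
  | add f g _ _ hf hg => exact Continuous.add hf hg
  | smul c f _ hf => exact Continuous.const_smul hf c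
end

section
/- (W, ∇⧢, ι, Δ⊙, ε) is a graded bialgebra over k: ∇⧢ is an associative product with unit element [∅,0], Δ⊙ is a coassociative coproduct with counit ε, the compatibility Δ⊙ ∘ ∇⧢ = (∇⧢ ⊗ ∇⧢) ∘ (id ⊗ τ ⊗ id) ∘ (Δ⊙ ⊗ Δ⊙) holds on W ⊗ W (where τ : W ⊗ W → W ⊗ W is the flip x ⊗ y ↦ y ⊗ x), ε is an algebra morphism, and all structure maps respect the grading (∇⧢ maps degree (i,j) to degree i+j, Δ⊙ maps degree n into the sum of degrees (i,j) with i+j=n, ι lands in degree 0, and ε vanishes on positive degrees). -/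
abbrev Word : Type := List ℕ+

def maxLetter (w : Word) : ℕ := w.foldr (fun a n => max (a : ℕ) n) 0

open Classical in
noncomputable def wRestrict (w : Word) (S : Set ℕ+) : Word :=
  w.filter fun a => decide (a ∈ S)

def wUp (m : ℕ) (w : Word) : Word :=
  w.map fun (a : ℕ+) => ⟨(a : ℕ) + m, Nat.add_pos_left a.pos m⟩

open scoped TensorProduct

/-- The basis set `𝕎`: pairs `[w,n]` with `max(w) ≤ n`. -/
def WIdx : Type := {p : Word × ℕ // ∀ a ∈ p.1, (a : ℕ) ≤ p.2}

/-- `W`: the free `k`-vector space on `𝕎`. -/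
abbrev WSpace (k : Type*) [Field k] : Type _ := WIdx →₀ k

variable (k : Type*) [Field k]

/-- `u` is a shuffle of `v` and `w ↑ m`:
`u ∩ {1,…,m} = v`, `u ∩ {m+1,…,m+n} = w ↑ m` and `ℓ(u) = ℓ(v) + ℓ(w)`. -/
def IsShuffle (m n : ℕ) (v w u : Word) : Prop :=
  wRestrict u {a : ℕ+ | (a : ℕ) ≤ m} = v ∧
  wRestrict u {a : ℕ+ | m < (a : ℕ) ∧ (a : ℕ) ≤ m + n} = wUp m w ∧
  u.length = v.length + w.length

/-- `∇⧢([v,m] ⊗ [w,n]) = Σ_u [u, m+n]` over all shuffles `u` of `v` and `w ↑ m`. -/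
noncomputable def shufProd (p q : WIdx) : WSpace k :=
  ∑ᶠ (u : WIdx) (_ : u.1.2 = p.1.2 + q.1.2 ∧ IsShuffle p.1.2 q.1.2 p.1.1 q.1.1 u.1.1),
    Finsupp.single u 1

/-- The shifted shuffle product `∇⧢` as a bilinear map. -/
noncomputable def mulW : WSpace k →ₗ[k] WSpace k →ₗ[k] WSpace k :=
  Finsupp.lift (WSpace k →ₗ[k] WSpace k) k WIdx fun p =>
    Finsupp.lift (WSpace k) k WIdx fun q => shufProd k p q

/-- `Δ⊙([w,n]) = Σ_i [w₁⋯wᵢ, n] ⊗ [wᵢ₊₁⋯, n]`, on a basis element. -/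
noncomputable def deconc (p : WIdx) : WSpace k ⊗[k] WSpace k :=
  ∑ i ∈ Finset.range (p.1.1.length + 1),
    (Finsupp.single (⟨(p.1.1.take i, p.1.2),
        fun a ha => p.2 a (List.take_subset i p.1.1 ha)⟩ : WIdx) (1 : k)) ⊗ₜ[k]
    (Finsupp.single (⟨(p.1.1.drop i, p.1.2),
        fun a ha => p.2 a (List.drop_subset i p.1.1 ha)⟩ : WIdx) (1 : k))

/-- The deconcatenation coproduct `Δ⊙`. -/
noncomputable def comulW : WSpace k →ₗ[k] WSpace k ⊗[k] WSpace k :=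
  Finsupp.lift (WSpace k ⊗[k] WSpace k) k WIdx (deconc k)

/-- The unit element `[∅, 0]`. -/
noncomputable def unitW : WSpace k :=
  Finsupp.single ⟨(([] : Word), 0), by intro a ha; simp at ha⟩ 1

/-- The counit `ε`. -/
noncomputable def counitW : WSpace k →ₗ[k] k :=
  Finsupp.lift k k WIdx fun p => if p.1.1 = [] then 1 else 0

/-- The degree-`d` homogeneous component of `W` (spanned by basis elements
`[w,n]` with `ℓ(w) = d`). -/
noncomputable def Wdeg (d : ℕ) : Submodule k (WSpace k) :=
  Submodule.span k {f : WSpace k | ∃ p : WIdx, p.1.1.length = d ∧ f = Finsupp.single p 1}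

section

namespace WIdx

/-- The word `w` of a pair `[w, n]`. -/
def word (p : WIdx) : Word := p.1.1

/-- The number `n` of a pair `[w, n]`. -/
def level (p : WIdx) : ℕ := p.1.2

theorem le_level (p : WIdx) {a : ℕ+} (ha : a ∈ p.word) : (a : ℕ) ≤ p.level := p.2 a ha

/-- The pair `[w, n]`. -/
def of (w : Word) (n : ℕ) (h : ∀ a ∈ w, (a : ℕ) ≤ n) : WIdx := ⟨(w, n), h⟩

@[simp] theorem word_of (w : Word) (n : ℕ) (h : ∀ a ∈ w, (a : ℕ) ≤ n) : (of w n h).word = w := rfl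

@[simp] theorem level_of (w : Word) (n : ℕ) (h : ∀ a ∈ w, (a : ℕ) ≤ n) :
    (of w n h).level = n := rfl

theorem ext_iff {p q : WIdx} : p = q ↔ p.word = q.word ∧ p.level = q.level :=
  Subtype.ext_iff.trans Prod.ext_iff

noncomputable instance : DecidableEq WIdx := Classical.decEq _

/-- The pair `[∅, n]`. -/
def empty (n : ℕ) : WIdx := of [] n (by simp)

@[simp] theorem word_empty (n : ℕ) : (empty n).word = [] := rfl

@[simp] theorem level_empty (n : ℕ) : (empty n).level = n := rfl

/-- The restriction of a word to the letters `1, …, m`, placed at level `m`. -/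
def low (m : ℕ) (u : WIdx) : WIdx :=
  of (u.word.filter fun a : ℕ+ => (a : ℕ) ≤ m) m fun a ha => by
    simpa using (List.mem_filter.1 ha).2

/-- The partial map on letters sending `a > m` to `a - m`. -/
def shiftDown (m : ℕ) (a : ℕ+) : Option ℕ+ :=
  if m < (a : ℕ) then some ((a : ℕ) - m).toPNat' else none

theorem shiftDown_eq_some {m : ℕ} {a b : ℕ+} :
    shiftDown m a = some b ↔ (a : ℕ) = b + m := by
  have hb := b.pos
  unfold shiftDown
  split_ifs with h
  · rw [Option.some_inj, ← PNat.coe_inj, Nat.toPNat'_coe, if_pos (by omega)]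
    omega
  · simp only [false_iff]
    omega

/-- The restriction of a word to the letters greater than `m`, shifted down by `m`. -/
def high (m : ℕ) (u : WIdx) : WIdx :=
  of (u.word.filterMap (shiftDown m)) (u.level - m) fun b hb => by
    obtain ⟨a, ha, hab⟩ := List.mem_filterMap.1 hb
    have := u.le_level ha
    have := shiftDown_eq_some.1 hab
    omega

/-- Concatenation of words. -/
def cat (s t : WIdx) : WIdx :=
  of (s.word ++ t.word) (max s.level t.level) fun a ha => by
    rcases List.mem_append.1 ha with h | h
    · exact le_max_of_le_left (s.le_level h)
    · exact le_max_of_le_right (t.le_level h)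

theorem low_word (m : ℕ) (u : WIdx) :
    (low m u).word = u.word.filter fun a : ℕ+ => (a : ℕ) ≤ m := rfl

theorem high_word (m : ℕ) (u : WIdx) : (high m u).word = u.word.filterMap (shiftDown m) := rfl

@[simp] theorem low_level (m : ℕ) (u : WIdx) : (low m u).level = m := rfl

@[simp] theorem high_level (m : ℕ) (u : WIdx) : (high m u).level = u.level - m := rfl

@[simp] theorem cat_level (s t : WIdx) : (cat s t).level = max s.level t.level := rfl

@[simp] theorem cat_word (s t : WIdx) : (cat s t).word = s.word ++ t.word := rfl

theorem low_low (a b : ℕ) (u : WIdx) : low a (low (a + b) u) = low a u := by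
  refine ext_iff.2 ⟨?_, rfl⟩
  simp only [low_word, List.filter_filter]
  refine List.filter_congr fun x _ => ?_
  rw [← Bool.decide_and, decide_eq_decide]
  omega

theorem high_low (a b : ℕ) (u : WIdx) : high a (low (a + b) u) = low b (high a u) := by
  refine ext_iff.2 ⟨?_, by simp⟩
  simp only [low_word, high_word, List.filterMap_filter, List.filter_filterMap]
  refine List.filterMap_congr fun x _ => ?_
  ext y
  simp only [Option.ite_none_right_eq_some, Option.filter_eq_some_iff, shiftDown_eq_some,
    decide_eq_true_eq]
  omega

theorem high_high (a b : ℕ) (u : WIdx) : high b (high a u) = high (a + b) u := by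
  refine ext_iff.2 ⟨?_, by simp [Nat.sub_sub]⟩
  simp only [high_word, List.filterMap_filterMap]
  refine List.filterMap_congr fun x _ => ?_
  ext y
  simp only [Option.bind_eq_some_iff, shiftDown_eq_some]
  constructor
  · rintro ⟨z, hz, hy⟩
    omega
  · intro h
    exact ⟨⟨y + b, by positivity⟩, by rw [PNat.mk_coe]; omega, rfl⟩

theorem low_self (u : WIdx) : low u.level u = u := by
  refine ext_iff.2 ⟨?_, rfl⟩
  exact List.filter_eq_self.2 fun a ha => by simpa using u.le_level ha

theorem high_zero (u : WIdx) : high 0 u = u := by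
  refine ext_iff.2 ⟨?_, rfl⟩
  have : shiftDown 0 = some := by
    ext a b
    rw [shiftDown_eq_some, Option.some_inj, ← PNat.coe_inj, add_zero]
  simp [high_word, this]

theorem low_cat (m : ℕ) (s t : WIdx) : low m (cat s t) = cat (low m s) (low m t) :=
  ext_iff.2 ⟨by simp [low_word], by simp⟩

theorem high_cat (m : ℕ) (s t : WIdx) : high m (cat s t) = cat (high m s) (high m t) :=
  ext_iff.2 ⟨by simp [high_word], by simp; omega⟩

theorem length_low_add_length_high (m : ℕ) (u : WIdx) :
    (low m u).word.length + (high m u).word.length = u.word.length := by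
  simp only [low_word, high_word]
  induction u.word with
  | nil => rfl
  | cons a l ih =>
    by_cases h : (a : ℕ) ≤ m
    · have : shiftDown m a = none := by simp [shiftDown, h]
      simp only [List.filter_cons, h, decide_true, if_true, List.length_cons,
        List.filterMap_cons, this]
      omega
    · have : shiftDown m a = some ((a : ℕ) - m).toPNat' := by
        simp [shiftDown, not_le.1 h]
      simp only [List.filter_cons, h, decide_false, Bool.false_eq_true, if_false,
        List.length_cons, List.filterMap_cons, this]
      omega

theorem finite_setOf_level_length (N d : ℕ) :
    {u : WIdx | u.level = N ∧ u.word.length = d}.Finite := by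
  have hA : Finite {a : ℕ+ // (a : ℕ) ≤ N} :=
    Finite.of_injective (fun a => (⟨a.1, Nat.lt_succ_of_le a.2⟩ : Fin (N + 1)))
      fun a b h => Subtype.ext (PNat.eq (by simpa using h))
  refine ((List.finite_length_eq {a : ℕ+ // (a : ℕ) ≤ N} d).image
    fun l => of (l.map Subtype.val) N fun a ha => by
      obtain ⟨b, -, rfl⟩ := List.mem_map.1 ha
      exact b.2).subset ?_
  rintro u ⟨rfl, rfl⟩
  refine ⟨u.word.attach.map fun a => ⟨a.1, u.le_level a.2⟩, by simp, ext_iff.2 ⟨?_, rfl⟩⟩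
  simp [List.map_map, Function.comp_def]

theorem finite_setOf_isShuffle (p q : WIdx) :
    {u : WIdx | u.level = p.level + q.level ∧ low p.level u = p ∧ high p.level u = q}.Finite := by
  refine (finite_setOf_level_length (p.level + q.level) (p.word.length + q.word.length)).subset ?_
  rintro u ⟨h, hp, hq⟩
  have := length_low_add_length_high p.level u
  rw [hp, hq] at this
  exact ⟨h, this.symm⟩

/-- The finite set of shifted shuffles of two words. -/
noncomputable def shuffles (p q : WIdx) : Finset WIdx := (finite_setOf_isShuffle p q).toFinset

theorem mem_shuffles {p q u : WIdx} :
    u ∈ shuffles p q ↔ u.level = p.level + q.level ∧ low p.level u = p ∧ high p.level u = q := by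
  simp [shuffles]

theorem length_of_mem_shuffles {p q u : WIdx} (h : u ∈ shuffles p q) :
    u.word.length = p.word.length + q.word.length := by
  obtain ⟨-, hp, hq⟩ := mem_shuffles.1 h
  have := length_low_add_length_high p.level u
  rw [hp, hq] at this
  exact this.symm

theorem wUp_injective (m : ℕ) : Function.Injective (wUp m) :=
  List.map_injective_iff.2 fun a b h => by
    have := congrArg PNat.val h
    exact PNat.eq (by simpa using this)

theorem wUp_high (m : ℕ) (u : WIdx) :
    wUp m (high m u).word = u.word.filter fun a : ℕ+ => m < (a : ℕ) := by
  rw [high_word, wUp]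
  refine (List.map_filterMap ..).trans (Eq.trans ?_ (congrFun List.filterMap_eq_filter u.word))
  refine List.filterMap_congr fun x _ => ?_
  ext y
  refine Option.map_eq_some_iff.trans ?_
  simp only [shiftDown_eq_some, Option.guard_eq_some_iff, decide_eq_true_eq]
  constructor
  · rintro ⟨z, hz, rfl⟩
    have := z.pos
    exact ⟨PNat.eq hz, by omega⟩
  · rintro ⟨rfl, h⟩
    have hx : (((x : ℕ) - m).toPNat' : ℕ) = x - m := by
      rw [Nat.toPNat'_coe, if_pos (by omega)]
    exact ⟨((x : ℕ) - m).toPNat', by omega, PNat.eq (by rw [PNat.mk_coe]; omega)⟩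

theorem isShuffle_iff_mem_shuffles {p q u : WIdx} :
    (u.level = p.level + q.level ∧ IsShuffle p.level q.level p.word q.word u.word) ↔ u ∈ shuffles p q := by
  have hlow : wRestrict u.word {a : ℕ+ | (a : ℕ) ≤ p.level} = (low p.level u).word := by
    rw [wRestrict, low_word]
    exact List.filter_congr fun _ _ => decide_eq_decide.2 Iff.rfl
  have hhigh (h : u.level = p.level + q.level) :
      wRestrict u.word {a : ℕ+ | p.level < (a : ℕ) ∧ (a : ℕ) ≤ p.level + q.level} =
        wUp p.level (high p.level u).word := by
    rw [wUp_high, wRestrict]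
    refine List.filter_congr fun a ha => ?_
    have := u.le_level ha
    simp only [Set.mem_ofPred_eq, decide_eq_decide]
    omega
  constructor
  · rintro ⟨h, h1, h2, -⟩
    rw [hlow] at h1
    rw [hhigh h] at h2
    exact mem_shuffles.2 ⟨h, ext_iff.2 ⟨h1, rfl⟩,
      ext_iff.2 ⟨wUp_injective _ h2, by simp [h]⟩⟩
  · intro hu
    obtain ⟨h, h1, h2⟩ := mem_shuffles.1 hu
    exact ⟨h, by rw [hlow, h1], by rw [hhigh h, h2], length_of_mem_shuffles hu⟩

/-- The prefix of length `i`, at the same level. -/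
def take (i : ℕ) (p : WIdx) : WIdx :=
  of (p.word.take i) p.level fun _ ha => p.le_level (List.take_subset i p.word ha)

/-- The suffix starting after `i` letters, at the same level. -/
def drop (i : ℕ) (p : WIdx) : WIdx :=
  of (p.word.drop i) p.level fun _ ha => p.le_level (List.drop_subset i p.word ha)

@[simp] theorem take_word (i : ℕ) (p : WIdx) : (take i p).word = p.word.take i := rfl

@[simp] theorem drop_word (i : ℕ) (p : WIdx) : (drop i p).word = p.word.drop i := rfl

@[simp] theorem take_level (i : ℕ) (p : WIdx) : (take i p).level = p.level := rfl

@[simp] theorem drop_level (i : ℕ) (p : WIdx) : (drop i p).level = p.level := rfl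

/-- The ways of cutting a word into a prefix and a suffix. -/
noncomputable def splits (p : WIdx) : Finset (WIdx × WIdx) :=
  (Finset.range (p.word.length + 1)).image fun i => (take i p, drop i p)

theorem mem_splits {p : WIdx} {x : WIdx × WIdx} :
    x ∈ splits p ↔ x.1.level = x.2.level ∧ cat x.1 x.2 = p := by
  obtain ⟨s, t⟩ := x
  simp only [splits, Finset.mem_image, Finset.mem_range, Prod.mk.injEq]
  constructor
  · rintro ⟨i, -, rfl, rfl⟩
    exact ⟨rfl, ext_iff.2 ⟨by simp, by simp⟩⟩
  · rintro ⟨h, rfl⟩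
    refine ⟨s.word.length, by simp, ext_iff.2 ⟨by simp, ?_⟩, ext_iff.2 ⟨by simp, ?_⟩⟩ <;>
      simp [h]

end WIdx

open WIdx Finset

theorem Finset.sum_sum_eq_sum_of_fiber {α β M : Type*} [AddCommMonoid M] {A : Finset α}
    {B : α → Finset β} {C : Finset β} (g : β → α) (f : β → M)
    (hC : ∀ y, y ∈ C ↔ g y ∈ A ∧ y ∈ B (g y)) (hB : ∀ x ∈ A, ∀ y ∈ B x, g y = x) :
    ∑ x ∈ A, ∑ y ∈ B x, f y = ∑ y ∈ C, f y := by
  classical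
  rw [← Finset.sum_fiberwise_of_maps_to (g := g) (t := A) fun y hy => ((hC y).1 hy).1]
  refine Finset.sum_congr rfl fun x hx => Finset.sum_congr ?_ fun _ _ => rfl
  ext y
  rw [Finset.mem_filter, hC]
  constructor
  · intro hy
    have := hB x hx y hy
    subst this
    exact ⟨⟨hx, hy⟩, rfl⟩
  · rintro ⟨⟨-, h⟩, rfl⟩
    exact h

theorem shufProd_eq_sum (p q : WIdx) :
    shufProd k p q = ∑ u ∈ shuffles p q, Finsupp.single u 1 := by
  rw [← finsum_mem_finset_eq_sum]
  exact finsum_congr fun u => finsum_congr_Prop (propext isShuffle_iff_mem_shuffles) fun _ => rfl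

theorem deconc_eq_sum (p : WIdx) :
    deconc k p = ∑ x ∈ splits p, Finsupp.single x.1 1 ⊗ₜ[k] Finsupp.single x.2 1 := by
  rw [splits, Finset.sum_image]
  · rfl
  · intro i hi j hj h
    have := congrArg (fun x : WIdx × WIdx => x.1.word.length) h
    simp only [coe_range, Set.mem_Iio, take_word, List.length_take] at this hi hj
    omega

theorem mulW_single (p q : WIdx) :
    mulW k (Finsupp.single p 1) (Finsupp.single q 1) =
      ∑ u ∈ shuffles p q, Finsupp.single u 1 := by
  simp [mulW, shufProd_eq_sum]

theorem comulW_single (p : WIdx) :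
    comulW k (Finsupp.single p 1) =
      ∑ x ∈ splits p, Finsupp.single x.1 1 ⊗ₜ[k] Finsupp.single x.2 1 := by
  simp [comulW, deconc_eq_sum]

theorem counitW_single (p : WIdx) :
    counitW k (Finsupp.single p 1) = if p.word = [] then 1 else 0 := by
  simp only [counitW, Finsupp.lift_apply, Finsupp.sum_single_index, zero_smul, one_smul]
  rfl

theorem mulW_assoc_single (p q r : WIdx) :
    mulW k (mulW k (Finsupp.single p 1) (Finsupp.single q 1)) (Finsupp.single r 1) =
      mulW k (Finsupp.single p 1) (mulW k (Finsupp.single q 1) (Finsupp.single r 1)) := by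
  simp only [mulW_single, map_sum, LinearMap.sum_apply]
  rw [Finset.sum_sum_eq_sum_of_fiber (A := shuffles q r) (B := fun s => shuffles p s)
    (C := (shuffles p q).biUnion fun s => shuffles s r) (high p.level)]
  · refine Finset.sum_sum_eq_sum_of_fiber (low (p.level + q.level)) _ ?_ ?_
    · intro u
      simp only [mem_biUnion]
      constructor
      · rintro ⟨s, hs, hu⟩
        have : low (p.level + q.level) u = s := by
          rw [← (mem_shuffles.1 hs).1]
          exact (mem_shuffles.1 hu).2.1
        rw [this]
        exact ⟨hs, hu⟩
      · exact fun h => ⟨_, h⟩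
    · intro s hs u hu
      rw [← (mem_shuffles.1 hs).1]
      exact (mem_shuffles.1 hu).2.1
  · intro u
    simp only [mem_biUnion, mem_shuffles, high_level, and_true]
    constructor
    · rintro ⟨s, ⟨hs, hp, hq⟩, hu, hsu, hr⟩
      rw [hs] at hsu hr
      rw [← hsu] at hp hq
      rw [low_low] at hp
      rw [high_low] at hq
      exact ⟨⟨by omega, hq, by rw [high_high, hr]⟩, by omega, hp⟩
    · rintro ⟨⟨h, hq, hr⟩, hu, hp⟩
      refine ⟨low (p.level + q.level) u, ⟨rfl, by rw [low_low, hp], by rw [high_low, hq]⟩, ?_, rfl, ?_⟩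
      · simp only [low_level]
        omega
      · rw [low_level, ← high_high, hr]
  · exact fun s _ u hu => (mem_shuffles.1 hu).2.2

theorem shuffles_unit_left (q : WIdx) : shuffles (empty 0) q = {q} := by
  ext u
  have h0 : low 0 u = empty 0 :=
    ext_iff.2 ⟨List.filter_eq_nil_iff.2 fun a _ => by simp, rfl⟩
  rw [mem_shuffles, mem_singleton]
  change u.level = 0 + q.level ∧ low 0 u = empty 0 ∧ high 0 u = q ↔ _
  rw [high_zero]
  constructor
  · exact fun h => h.2.2
  · rintro rfl
    exact ⟨(zero_add _).symm, h0, rfl⟩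

theorem shuffles_unit_right (p : WIdx) : shuffles p (empty 0) = {p} := by
  ext u
  rw [mem_shuffles, mem_singleton]
  change u.level = p.level ∧ _ ↔ _
  constructor
  · rintro ⟨h, hp, -⟩
    rwa [← h, low_self] at hp
  · rintro rfl
    refine ⟨rfl, low_self u, ext_iff.2 ⟨List.filterMap_eq_nil_iff.2 fun a ha => ?_, ?_⟩⟩
    · simpa [shiftDown] using u.le_level ha
    · simp

theorem WIdx.cat_assoc (s t u : WIdx) : cat (cat s t) u = cat s (cat t u) :=
  ext_iff.2 ⟨by simp, by simp [max_assoc]⟩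

theorem sum_splits_assoc {M : Type*} [AddCommMonoid M] (p : WIdx) (f : WIdx → WIdx → WIdx → M) :
    ∑ x ∈ splits p, ∑ y ∈ splits x.1, f y.1 y.2 x.2 =
      ∑ x ∈ splits p, ∑ y ∈ splits x.2, f x.1 y.1 y.2 := by
  rw [Finset.sum_sigma', Finset.sum_sigma']
  refine Finset.sum_bij' (fun z _ => ⟨(z.2.1, cat z.2.2 z.1.2), (z.2.2, z.1.2)⟩)
    (fun z _ => ⟨(cat z.1.1 z.2.1, z.2.2), (z.1.1, z.2.1)⟩) ?_ ?_ ?_ ?_ ?_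
  · rintro ⟨⟨s, t⟩, ⟨s₁, s₂⟩⟩ h
    simp only [mem_sigma, mem_splits, and_true] at h ⊢
    obtain ⟨⟨h, rfl⟩, h', rfl⟩ := h
    simp only [cat_level] at h ⊢
    exact ⟨⟨by omega, (cat_assoc _ _ _).symm⟩, by omega⟩
  · rintro ⟨⟨s, t⟩, ⟨t₁, t₂⟩⟩ h
    simp only [mem_sigma, mem_splits, and_true] at h ⊢
    obtain ⟨⟨h, rfl⟩, h', rfl⟩ := h
    simp only [cat_level] at h ⊢
    exact ⟨⟨by omega, cat_assoc _ _ _⟩, by omega⟩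
  · rintro ⟨⟨s, t⟩, ⟨s₁, s₂⟩⟩ h
    simp only [mem_sigma, mem_splits] at h
    obtain ⟨-, -, rfl⟩ := h
    rfl
  · rintro ⟨⟨s, t⟩, ⟨t₁, t₂⟩⟩ h
    simp only [mem_sigma, mem_splits] at h
    obtain ⟨-, -, rfl⟩ := h
    rfl
  · intros
    rfl

theorem sum_splits_shuffles {M : Type*} [AddCommMonoid M] (p q : WIdx)
    (f : WIdx × WIdx → M) :
    ∑ u ∈ shuffles p q, ∑ x ∈ splits u, f x =
      ∑ z ∈ splits p ×ˢ splits q, ∑ x ∈ shuffles z.1.1 z.2.1 ×ˢ shuffles z.1.2 z.2.2, f x := by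
  rw [Finset.sum_sum_eq_sum_of_fiber (A := shuffles p q) (B := splits)
    (C := (shuffles p q).biUnion splits) fun x => cat x.1 x.2]
  · symm
    refine Finset.sum_sum_eq_sum_of_fiber (fun x =>
      ((low p.level x.1, low p.level x.2), (high p.level x.1, high p.level x.2))) _ ?_ ?_
    · rintro ⟨s, t⟩
      simp only [mem_biUnion, mem_product, mem_splits, mem_shuffles, low_level, high_level,
        and_true, true_and]
      constructor
      · rintro ⟨u, ⟨hu, hp, hq⟩, h, rfl⟩
        rw [low_cat] at hp
        rw [high_cat] at hq
        rw [cat_level] at hu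
        exact ⟨⟨hp, by omega, hq⟩, by omega, by omega⟩
      · rintro ⟨⟨hp, h, hq⟩, hs, ht⟩
        have hl := congrArg (fun u : WIdx => u.level) hq
        simp only [cat_level, high_level] at hl
        refine ⟨cat s t, ⟨?_, by rw [low_cat, hp], by rw [high_cat, hq]⟩, by omega, rfl⟩
        rw [cat_level]
        omega
    · rintro ⟨⟨p₁, p₂⟩, q₁, q₂⟩ hz ⟨s, t⟩ hx
      simp only [mem_product, mem_splits, mem_shuffles] at hz hx
      obtain ⟨⟨hp, rfl⟩, hq, rfl⟩ := hz
      obtain ⟨⟨hs, hs₁, hs₂⟩, ht, ht₁, ht₂⟩ := hx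
      simp only [cat_level, ← hp, max_self] at hs₁ hs₂ ht₁ ht₂ ⊢
      rw [hs₁, hs₂, ht₁, ht₂]
  · rintro ⟨s, t⟩
    simp only [mem_biUnion, mem_splits]
    constructor
    · rintro ⟨u, hu, h, rfl⟩
      exact ⟨hu, h, trivial⟩
    · rintro ⟨hu, h, -⟩
      exact ⟨_, hu, h, rfl⟩
  · exact fun u _ x hx => (mem_splits.1 hx).2

theorem counitW_mulW_single (p q : WIdx) :
    counitW k (mulW k (Finsupp.single p 1) (Finsupp.single q 1)) =
      counitW k (Finsupp.single p 1) * counitW k (Finsupp.single q 1) := by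
  simp only [mulW_single, map_sum, counitW_single]
  by_cases h : p.word = [] ∧ q.word = []
  · have : shuffles p q = {empty (p.level + q.level)} := by
      ext u
      rw [mem_singleton]
      constructor
      · intro hu
        have hl := length_of_mem_shuffles hu
        rw [h.1, h.2] at hl
        exact ext_iff.2 ⟨List.eq_nil_of_length_eq_zero hl, (mem_shuffles.1 hu).1⟩
      · rintro rfl
        exact mem_shuffles.2 ⟨rfl, ext_iff.2 ⟨by simp [low_word, h.1], rfl⟩,
          ext_iff.2 ⟨by simp [high_word, h.2], by simp⟩⟩
    rw [this, sum_singleton]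
    simp [h.1, h.2]
  · rw [Finset.sum_eq_zero]
    · rw [not_and_or] at h
      rcases h with h | h <;> simp [h]
    · intro u hu
      refine if_neg fun h0 => h ?_
      have hl := length_of_mem_shuffles hu
      rw [h0, List.length_nil] at hl
      constructor <;> apply List.eq_nil_of_length_eq_zero <;> omega

theorem sum_splits_counit_left (p : WIdx) :
    ∑ x ∈ splits p, counitW k (Finsupp.single x.1 1) • Finsupp.single x.2 (1 : k) =
      Finsupp.single p 1 := by
  rw [Finset.sum_eq_single (empty p.level, p)]
  · simp [counitW_single]
  · rintro ⟨s, t⟩ hx hne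
    obtain ⟨h, rfl⟩ := mem_splits.1 hx
    rw [counitW_single, if_neg, zero_smul]
    change s.level = t.level at h
    intro hs
    change s.word = [] at hs
    refine hne (Prod.ext (ext_iff.2 ⟨hs, ?_⟩) (ext_iff.2 ⟨?_, ?_⟩)) <;> simp [h, hs]
  · intro h
    exact absurd (mem_splits.2 ⟨rfl, ext_iff.2 ⟨by simp, by simp⟩⟩) h

theorem sum_splits_counit_right (p : WIdx) :
    ∑ x ∈ splits p, counitW k (Finsupp.single x.2 1) • Finsupp.single x.1 (1 : k) =
      Finsupp.single p 1 := by
  rw [Finset.sum_eq_single (p, empty p.level)]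
  · simp [counitW_single]
  · rintro ⟨s, t⟩ hx hne
    obtain ⟨h, rfl⟩ := mem_splits.1 hx
    rw [counitW_single, if_neg, zero_smul]
    change s.level = t.level at h
    intro ht
    change t.word = [] at ht
    refine hne (Prod.ext (ext_iff.2 ⟨?_, ?_⟩) (ext_iff.2 ⟨ht, ?_⟩)) <;> simp [h, ht]
  · intro h
    exact absurd (mem_splits.2 ⟨rfl, ext_iff.2 ⟨by simp, by simp⟩⟩) h

theorem Wdeg_eq_span (d : ℕ) : Wdeg k d =
    Submodule.span k {f : WSpace k | ∃ p : WIdx, p.word.length = d ∧ f = Finsupp.single p 1} :=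
  rfl

theorem single_mem_Wdeg (p : WIdx) : Finsupp.single p 1 ∈ Wdeg k p.word.length :=
  Submodule.subset_span ⟨p, rfl, rfl⟩

theorem mulW_mem_Wdeg {i j : ℕ} {x y : WSpace k} (hx : x ∈ Wdeg k i) (hy : y ∈ Wdeg k j) :
    mulW k x y ∈ Wdeg k (i + j) := by
  rw [Wdeg_eq_span] at hx hy
  refine LinearMap.BilinMap.apply_apply_mem_of_mem_span _ _ _ (mulW k) ?_ x y hx hy
  rintro _ ⟨p, rfl, rfl⟩ _ ⟨q, rfl, rfl⟩
  rw [mulW_single]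
  refine Submodule.sum_mem _ fun u hu => ?_
  rw [← length_of_mem_shuffles hu]
  exact single_mem_Wdeg k u

theorem comulW_mem {n : ℕ} {x : WSpace k} (hx : x ∈ Wdeg k n) :
    comulW k x ∈ Submodule.span k {t : WSpace k ⊗[k] WSpace k |
      ∃ i j : ℕ, ∃ a b : WSpace k,
        i + j = n ∧ a ∈ Wdeg k i ∧ b ∈ Wdeg k j ∧ t = a ⊗ₜ[k] b} := by
  rw [Wdeg_eq_span] at hx
  rw [← Submodule.mem_comap]
  refine (Submodule.span_le (p := Submodule.comap (comulW k) _)).2 ?_ hx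
  rintro _ ⟨p, rfl, rfl⟩
  rw [SetLike.mem_coe, Submodule.mem_comap, comulW_single]
  refine Submodule.sum_mem _ fun x hx => Submodule.subset_span ⟨_, _, _, _, ?_,
    single_mem_Wdeg k x.1, single_mem_Wdeg k x.2, rfl⟩
  rw [← (mem_splits.1 hx).2, cat_word, List.length_append]

theorem counitW_eq_zero {n : ℕ} (hn : 0 < n) {x : WSpace k} (hx : x ∈ Wdeg k n) :
    counitW k x = 0 := by
  rw [Wdeg_eq_span] at hx
  rw [← LinearMap.mem_ker]
  refine Submodule.span_le.2 ?_ hx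
  rintro _ ⟨p, rfl, rfl⟩
  rw [SetLike.mem_coe, LinearMap.mem_ker, counitW_single, if_neg]
  exact List.ne_nil_of_length_pos hn

theorem mulW_assoc (x y z : WSpace k) : mulW k (mulW k x y) z = mulW k x (mulW k y z) := by
  induction x using Finsupp.induction_linear with
  | zero => simp
  | add x x' hx hx' => simp [hx, hx']
  | single p a =>
  induction y using Finsupp.induction_linear with
  | zero => simp
  | add y y' hy hy' => simp [hy, hy']
  | single q b =>
  induction z using Finsupp.induction_linear with
  | zero => simp
  | add z z' hz hz' => simp [hz, hz']
  | single r c =>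
  rw [← mul_one a, ← mul_one b, ← mul_one c]
  simp only [← smul_eq_mul, ← Finsupp.smul_single, map_smul, LinearMap.smul_apply,
    mulW_assoc_single]

theorem counitW_mulW (x y : WSpace k) :
    counitW k (mulW k x y) = counitW k x * counitW k y := by
  have : (mulW k).compr₂ (counitW k) = (LinearMap.mul k k).compl₁₂ (counitW k) (counitW k) := by
    ext p q
    simpa using counitW_mulW_single k p q
  simpa using LinearMap.congr_fun₂ this x y

theorem unitW_mulW (x : WSpace k) : mulW k (unitW k) x = x := by
  have : mulW k (unitW k) = LinearMap.id := by
    refine Finsupp.lhom_ext' fun p => LinearMap.ext_ring ?_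
    change mulW k (Finsupp.single (empty 0) 1) (Finsupp.single p 1) = _
    simp [mulW_single, shuffles_unit_left]
  rw [this, LinearMap.id_apply]

theorem mulW_unitW (x : WSpace k) : mulW k x (unitW k) = x := by
  have : (mulW k).flip (unitW k) = LinearMap.id := by
    refine Finsupp.lhom_ext' fun p => LinearMap.ext_ring ?_
    change mulW k (Finsupp.single p 1) (Finsupp.single (empty 0) 1) = _
    simp [mulW_single, shuffles_unit_right]
  rw [← LinearMap.flip_apply, this, LinearMap.id_apply]

theorem comulW_coassoc :
    (TensorProduct.assoc k (WSpace k) (WSpace k) (WSpace k)).toLinearMap ∘ₗ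
        TensorProduct.map (comulW k) LinearMap.id ∘ₗ comulW k =
      TensorProduct.map LinearMap.id (comulW k) ∘ₗ comulW k := by
  refine Finsupp.lhom_ext' fun p => LinearMap.ext_ring ?_
  simp only [LinearMap.comp_apply, Finsupp.lsingle_apply, comulW_single, map_sum,
    TensorProduct.map_tmul, LinearMap.id_apply, TensorProduct.sum_tmul, TensorProduct.tmul_sum,
    LinearEquiv.coe_coe, TensorProduct.assoc_tmul]
  exact sum_splits_assoc p fun s t u =>
    Finsupp.single s 1 ⊗ₜ[k] (Finsupp.single t 1 ⊗ₜ[k] Finsupp.single u 1)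

theorem comulW_counit_left :
    (TensorProduct.lid k (WSpace k)).toLinearMap ∘ₗ
        TensorProduct.map (counitW k) LinearMap.id ∘ₗ comulW k = LinearMap.id := by
  refine Finsupp.lhom_ext' fun p => LinearMap.ext_ring ?_
  simp only [LinearMap.comp_apply, Finsupp.lsingle_apply, comulW_single, map_sum,
    TensorProduct.map_tmul, LinearMap.id_apply, LinearEquiv.coe_coe, TensorProduct.lid_tmul]
  exact sum_splits_counit_left k p

theorem comulW_counit_right :
    (TensorProduct.rid k (WSpace k)).toLinearMap ∘ₗ
        TensorProduct.map LinearMap.id (counitW k) ∘ₗ comulW k = LinearMap.id := by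
  refine Finsupp.lhom_ext' fun p => LinearMap.ext_ring ?_
  simp only [LinearMap.comp_apply, Finsupp.lsingle_apply, comulW_single, map_sum,
    TensorProduct.map_tmul, LinearMap.id_apply, LinearEquiv.coe_coe, TensorProduct.rid_tmul]
  exact sum_splits_counit_right k p

theorem comulW_mulW :
    comulW k ∘ₗ TensorProduct.lift (mulW k) =
      TensorProduct.map (TensorProduct.lift (mulW k)) (TensorProduct.lift (mulW k)) ∘ₗ
        (TensorProduct.tensorTensorTensorComm k (WSpace k) (WSpace k) (WSpace k)
            (WSpace k)).toLinearMap ∘ₗ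
        TensorProduct.map (comulW k) (comulW k) := by
  refine TensorProduct.ext (Finsupp.lhom_ext' fun p => LinearMap.ext_ring
    (Finsupp.lhom_ext' fun q => LinearMap.ext_ring ?_))
  change comulW k (TensorProduct.lift (mulW k)
      (Finsupp.single p 1 ⊗ₜ[k] Finsupp.single q 1)) =
    TensorProduct.map (TensorProduct.lift (mulW k)) (TensorProduct.lift (mulW k))
      (TensorProduct.tensorTensorTensorComm k (WSpace k) (WSpace k) (WSpace k) (WSpace k)
        (TensorProduct.map (comulW k) (comulW k)
          (Finsupp.single p 1 ⊗ₜ[k] Finsupp.single q 1)))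
  simp only [TensorProduct.lift.tmul, TensorProduct.map_tmul, mulW_single, comulW_single, map_sum]
  rw [sum_splits_shuffles p q fun x => Finsupp.single x.1 1 ⊗ₜ[k] Finsupp.single x.2 1,
    TensorProduct.sum_tmul, Finset.sum_product]
  simp only [TensorProduct.tmul_sum, map_sum]
  refine Finset.sum_congr rfl fun x _ => Finset.sum_congr rfl fun y _ => ?_
  simp only [TensorProduct.tensorTensorTensorComm_tmul, TensorProduct.map_tmul,
    TensorProduct.lift.tmul, mulW_single, Finset.sum_product]
  rw [TensorProduct.sum_tmul]
  simp only [TensorProduct.tmul_sum]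

end

theorem stmt4 :
    -- `∇⧢` is associative
    (∀ x y z : WSpace k, mulW k (mulW k x y) z = mulW k x (mulW k y z)) ∧
    -- with unit element `[∅,0]`
    (∀ x : WSpace k, mulW k (unitW k) x = x ∧ mulW k x (unitW k) = x) ∧
    -- `Δ⊙` is coassociative
    ((TensorProduct.assoc k (WSpace k) (WSpace k) (WSpace k)).toLinearMap ∘ₗ
        TensorProduct.map (comulW k) LinearMap.id ∘ₗ comulW k =
      TensorProduct.map LinearMap.id (comulW k) ∘ₗ comulW k) ∧
    -- with counit `ε`
    ((TensorProduct.lid k (WSpace k)).toLinearMap ∘ₗ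
        TensorProduct.map (counitW k) LinearMap.id ∘ₗ comulW k = LinearMap.id) ∧
    ((TensorProduct.rid k (WSpace k)).toLinearMap ∘ₗ
        TensorProduct.map LinearMap.id (counitW k) ∘ₗ comulW k = LinearMap.id) ∧
    -- compatibility: Δ⊙ ∘ ∇⧢ = (∇⧢ ⊗ ∇⧢) ∘ (id ⊗ τ ⊗ id) ∘ (Δ⊙ ⊗ Δ⊙)
    (comulW k ∘ₗ TensorProduct.lift (mulW k) =
      TensorProduct.map (TensorProduct.lift (mulW k)) (TensorProduct.lift (mulW k)) ∘ₗ
        (TensorProduct.tensorTensorTensorComm k (WSpace k) (WSpace k) (WSpace k)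
            (WSpace k)).toLinearMap ∘ₗ
        TensorProduct.map (comulW k) (comulW k)) ∧
    -- `ε` is an algebra morphism
    (counitW k (unitW k) = 1 ∧
      ∀ x y : WSpace k, counitW k (mulW k x y) = counitW k x * counitW k y) ∧
    -- the structure maps respect the grading
    (∀ i j : ℕ, ∀ x ∈ Wdeg k i, ∀ y ∈ Wdeg k j, mulW k x y ∈ Wdeg k (i + j)) ∧
    (unitW k ∈ Wdeg k 0) ∧
    (∀ n : ℕ, ∀ x ∈ Wdeg k n, comulW k x ∈
      Submodule.span k {t : WSpace k ⊗[k] WSpace k |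
        ∃ i j : ℕ, ∃ a b : WSpace k,
          i + j = n ∧ a ∈ Wdeg k i ∧ b ∈ Wdeg k j ∧ t = a ⊗ₜ[k] b}) ∧
    (∀ n : ℕ, 0 < n → ∀ x ∈ Wdeg k n, counitW k x = 0) := by
  exact ⟨mulW_assoc k, fun x => ⟨unitW_mulW k x, mulW_unitW k x⟩, comulW_coassoc k,
    comulW_counit_left k, comulW_counit_right k, comulW_mulW k,
    ⟨by exact (counitW_single k (WIdx.empty 0)).trans (if_pos rfl), counitW_mulW k⟩,
    fun _ _ _ hx _ hy => mulW_mem_Wdeg k hx hy, single_mem_Wdeg k (WIdx.empty 0),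
    fun _ _ hx => comulW_mem k hx, fun _ hn _ hx => counitW_eq_zero k hn hx⟩
end
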